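/- arXiv:1105.5578 — 2 statements merged into one kernel-verified Lean document; each statement's English description precedes it below -/
import Mathlib

section
/- Let B ≥ 1 be an integer and let X be a random variable taking values in the lattice G = {0, 1/B, 2/B, ..., 1} whose probability mass function is unimodal. Let η = E[X] and suppose η ≤ 1/3. Then for every t = j/B ∈ G with 1/2 < t ≤ 1, one has P(X ≥ t) ≤ 2η(1 − t + 1/B)/(1 + 1/B). -/
open MeasureTheory

/-- A probability mass function `f` on the lattice `{0, 1/B, ..., 1}` (indexed by
`{0, 1, ..., B}`) is unimodal if it increases up to some mode `m ≤ B` and decreases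
afterwards. -/
def UnimodalOn (B : ℕ) (f : ℕ → ℝ) : Prop :=
  ∃ m ≤ B, (∀ i j, i ≤ j → j ≤ m → f i ≤ f j) ∧ (∀ i j, m ≤ i → i ≤ j → j ≤ B → f j ≤ f i)

open Finset in
/-- Summation by parts against a unimodal weight: if `F` takes smaller values up to the mode than
after it, the weighted sum of the increments of `F` is nonnegative. -/
lemma UnimodalOn.sum_mul_increment_nonneg {B m : ℕ} {p F : ℕ → ℝ} (hm : m ≤ B)
    (hp : ∀ i, 0 ≤ p i) (hinc : ∀ i j, i ≤ j → j ≤ m → p i ≤ p j)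
    (hdec : ∀ i j, m ≤ i → i ≤ j → j ≤ B → p j ≤ p i)
    (hF : ∀ a b, a ≤ m → m < b → b ≤ B + 1 → F a ≤ F b) :
    0 ≤ ∑ i ∈ range (B + 1), p i * (F (i + 1) - F i) := by
  obtain ⟨a₀, ha₀, hmax⟩ := exists_max_image (range (m + 1)) F ⟨0, by simp⟩
  have key : ∀ n ≤ B, p n * (F (n + 1) - F a₀) ≤
      ∑ i ∈ range (n + 1), p i * (F (i + 1) - F i) := by
    intro n
    induction n with
    | zero =>
      intro _
      have h := hmax 0 (by simp)
      simp only [zero_add, sum_range_one]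
      exact mul_le_mul_of_nonneg_left (by linarith) (hp 0)
    | succ n ih =>
      intro hn
      rw [sum_range_succ]
      have h1 := ih (by omega)
      have h2 : 0 ≤ (p n - p (n + 1)) * (F (n + 1) - F a₀) := by
        rcases lt_or_ge n m with h | h
        · exact mul_nonneg_of_nonpos_of_nonpos
            (by linarith [hinc n (n + 1) (by omega) (by omega)])
            (by linarith [hmax (n + 1) (by simp; omega)])
        · refine mul_nonneg (by linarith [hdec n (n + 1) h (by omega) hn]) ?_
          linarith [hF a₀ (n + 1) (by simp at ha₀; omega) (by omega) (by omega)]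
      nlinarith
  refine le_trans (mul_nonneg (hp B) ?_) (key B le_rfl)
  linarith [hF a₀ (B + 1) (by simp at ha₀; omega) (by omega) le_rfl]

open Finset in
/-- A linear bound on the tail of a unimodal probability mass function in terms of its mean follows
from the same bound for the uniform distributions on the intervals `[a, b)` containing the mode. -/
lemma UnimodalOn.tail_le_of_interval {B m j : ℕ} {p : ℕ → ℝ} (hm : m ≤ B)
    (hp : ∀ i, 0 ≤ p i) (hinc : ∀ i j, i ≤ j → j ≤ m → p i ≤ p j)
    (hdec : ∀ i j, m ≤ i → i ≤ j → j ≤ B → p j ≤ p i)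
    (hsum : ∑ i ∈ range (B + 1), p i = 1) (α β γ : ℝ)
    (h : ∀ a b : ℕ, a ≤ m → m < b → b ≤ B + 1 →
      γ * (((b - j : ℕ) : ℝ) - ((a - j : ℕ) : ℝ)) ≤
        ((b : ℝ) - a) * (α * ((a + b - 1) / 2) - β)) :
    γ * ∑ i ∈ range (B + 1), p i * (if j ≤ i then 1 else 0) ≤
      α * (∑ i ∈ range (B + 1), p i * i) - β := by
  have key := UnimodalOn.sum_mul_increment_nonneg (B := B) (m := m) (p := p)
    (F := fun n => α * (n * (n - 1) / 2) - β * n - γ * ((n - j : ℕ) : ℝ)) hm hp hinc hdec (by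
      intro a b h1 h2 h3
      have := h a b h1 h2 h3
      nlinarith)
  have e : ∀ i ∈ range (B + 1), p i * ((α * (((i + 1 : ℕ) : ℝ) * (((i + 1 : ℕ) : ℝ) - 1) / 2)
      - β * ((i + 1 : ℕ) : ℝ) - γ * ((i + 1 - j : ℕ) : ℝ)) -
      (α * ((i : ℝ) * (i - 1) / 2) - β * i - γ * ((i - j : ℕ) : ℝ))) =
      α * (p i * i) - β * p i - γ * (p i * (if j ≤ i then 1 else 0)) := by
    intro i _
    split_ifs with hi
    · rw [Nat.cast_sub hi, Nat.cast_sub (by omega : j ≤ i + 1)]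
      push_cast
      ring
    · rw [Nat.sub_eq_zero_of_le (by omega : i ≤ j), Nat.sub_eq_zero_of_le (by omega : i + 1 ≤ j)]
      push_cast
      ring
  rw [sum_congr rfl e, sum_sub_distrib, sum_sub_distrib, ← mul_sum, ← mul_sum, ← mul_sum,
    hsum] at key
  linarith

open Finset in
/-- The unimodal Markov inequality for thresholds above one half, for probability mass functions
on `{0, ..., B}` with mean at most `B / 3`. -/
lemma UnimodalOn.markov {B j : ℕ} {p : ℕ → ℝ} (hB : 1 ≤ B) (hu : UnimodalOn B p)
    (hp : ∀ i, 0 ≤ p i) (hsum : ∑ i ∈ range (B + 1), p i = 1) (η : ℝ)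
    (hη : ∑ i ∈ range (B + 1), p i * i = B * η) (hη3 : η ≤ 1 / 3) (hjB : j ≤ B)
    (hj : B < 2 * j) :
    (B + 1 : ℝ) * ∑ i ∈ range (B + 1), p i * (if j ≤ i then 1 else 0) ≤
      2 * (B + 1 - j) * η := by
  obtain ⟨m, hm, hinc, hdec⟩ := hu
  have main := UnimodalOn.tail_le_of_interval (j := j) hm hp hinc hdec hsum
  rw [hη] at main
  set T := ∑ i ∈ range (B + 1), p i * (if j ≤ i then (1 : ℝ) else 0)
  have hB' : (1 : ℝ) ≤ B := by exact_mod_cast hB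
  have hm' : (m : ℝ) ≤ B := by exact_mod_cast hm
  have hm0 : (0 : ℝ) ≤ m := by positivity
  have hjB' : (j : ℝ) ≤ B := by exact_mod_cast hjB
  have hj' : (B : ℝ) + 1 ≤ 2 * j := by exact_mod_cast hj
  rcases le_or_gt j m with hjm | hjm
  · have hjm' : (j : ℝ) ≤ m := by exact_mod_cast hjm
    have hD : (0 : ℝ) < 3 * (j + m) - 2 * B := by linarith
    have h := main (2 * (B + 1 + 2 * j)) (2 * B * (B + 1) - 2 * (B + 1 - j) * (j + m))
      ((B + 1) * (3 * (j + m) - 2 * B)) ?_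
    · have h3 : 0 ≤ (2 * B * (B + 1) - 2 * (B + 1 - j) * (j + m) : ℝ) * (1 - 3 * η) := by
        refine mul_nonneg ?_ (by linarith)
        nlinarith [mul_nonneg (sub_nonneg.2 hj') (add_nonneg hm0 (by linarith : (0:ℝ) ≤ j))]
      refine le_of_mul_le_mul_left ?_ hD
      linarith
    · intro a b ha hb hbB
      have ha' : (a : ℝ) ≤ m := by exact_mod_cast ha
      have hb' : (m : ℝ) + 1 ≤ b := by exact_mod_cast hb
      have ha0 : (0 : ℝ) ≤ a := by positivity
      rw [Nat.cast_sub (by omega : j ≤ b)]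
      rcases le_or_gt j a with hja | hja
      · rw [Nat.cast_sub hja]
        have hja' : (j : ℝ) ≤ a := by exact_mod_cast hja
        have : 0 ≤ ((b : ℝ) - a) * ((B + 1 + 2 * j) * ((a + b - 1) - (j + m))) :=
          mul_nonneg (by linarith) (mul_nonneg (by linarith) (by linarith))
        linarith
      · rw [Nat.sub_eq_zero_of_le hja.le]
        have hja' : (a : ℝ) ≤ j := by exact_mod_cast hja.le
        obtain ⟨u, hu⟩ : ∃ u : ℝ, u = j - a := ⟨_, rfl⟩
        obtain ⟨v, hv⟩ : ∃ v : ℝ, v = b - 1 - m := ⟨_, rfl⟩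
        obtain ⟨w, hw⟩ : ∃ w : ℝ, w = m - j := ⟨_, rfl⟩
        have hu0 : 0 ≤ u := by linarith
        have hv0 : 0 ≤ v := by linarith
        have hw0 : 0 ≤ w := by linarith
        have h1 : 0 ≤ (B + 1) * (3 * (j + m) - 2 * B) - (B + 1 + 2 * j) * (m + 1 : ℝ) := by
          have e1 : 0 ≤ (2 * j - (B + 1)) * (2 * (B + 1) - j - 1 : ℝ) :=
            mul_nonneg (by linarith) (by linarith)
          have e2 : 0 ≤ (B + 1 - j : ℝ) * (m - j) := mul_nonneg (by linarith) (by linarith)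
          linarith
        have h2 := mul_nonneg h1 hu0
        have h3 : 0 ≤ (B + 1 + 2 * j : ℝ) * (u * (m + 1) - (u - v) * (u + v + w + 1)) := by
          refine mul_nonneg (by linarith) ?_
          have : 0 ≤ u * a := mul_nonneg hu0 ha0
          have e : (m : ℝ) + 1 = a + u + w + 1 := by linarith
          rw [e]
          have := mul_nonneg hv0 hv0
          have := mul_nonneg hv0 hw0
          linarith
        have e1 : (a : ℝ) = j - u := by linarith
        have e2 : (b : ℝ) = v + 1 + j + w := by linarith
        have e3 : (m : ℝ) = j + w := by linarith
        rw [e3] at h2 h3 ⊢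
        rw [e1, e2]
        push_cast
        linarith
  · have hjm' : (m : ℝ) + 1 ≤ j := by exact_mod_cast hjm
    rcases lt_or_ge (3 * m) (2 * B) with hE | hE
    · have hE' : (0 : ℝ) < 2 * B - 3 * m := by
        have : (3 * m : ℝ) < 2 * B := by exact_mod_cast hE
        linarith
      have h := main (4 * (B + 1 - j)) (2 * (B + 1 - j) * m) ((B + 1) * (2 * B - 3 * m)) ?_
      · have h3 : 0 ≤ ((B + 1 - j) * m : ℝ) * (1 - 3 * η) :=
          mul_nonneg (mul_nonneg (by linarith) hm0) (by linarith)
        refine le_of_mul_le_mul_left ?_ hE'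
        linarith
      · intro a b ha hb hbB
        have ha' : (a : ℝ) ≤ m := by exact_mod_cast ha
        have hb' : (m : ℝ) + 1 ≤ b := by exact_mod_cast hb
        have ha0 : (0 : ℝ) ≤ a := by positivity
        rw [Nat.sub_eq_zero_of_le (by omega : a ≤ j)]
        rcases le_or_gt b j with hbj | hbj
        · rw [Nat.sub_eq_zero_of_le hbj]
          have : 0 ≤ ((b : ℝ) - a) * ((B + 1 - j) * (a + (b - 1 - m))) :=
            mul_nonneg (by linarith) (mul_nonneg (by linarith) (by linarith))
          push_cast
          linarith
        · rw [Nat.cast_sub hbj.le]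
          have hbj' : (j : ℝ) + 1 ≤ b := by exact_mod_cast hbj
          have hbB' : (b : ℝ) ≤ B + 1 := by exact_mod_cast hbB
          have h0 : ((b : ℝ) - j) * (B + 1) * B ≤ (B + 1 - j) * ((b - 1) * b) := by
            have : 0 ≤ (B + 1 - b) * ((j - 1) * (B + 1) - (B + 1 - j) * (b - 1) : ℝ) := by
              rcases eq_or_lt_of_le hbB with e | e
              · have : (b : ℝ) = B + 1 := by exact_mod_cast e
                simp [this]
              · have e' : (b : ℝ) ≤ B := by exact_mod_cast Nat.lt_succ_iff.1 e
                refine mul_nonneg (by linarith) ?_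
                nlinarith [mul_nonneg (by linarith : (0:ℝ) ≤ B + 1 - j) (sub_nonneg.2 e')]
            linarith
          have h1 : ((b : ℝ) - j) * (B + 1) * (2 * B - 3 * (j - 1)) ≤
              2 * (B + 1 - j) * ((b - j) * b) := by
            have e1 : 0 ≤ (2 * j - (B + 1)) * (2 * (B + 1) - j - 1 : ℝ) :=
              mul_nonneg (by linarith) (by linarith)
            have e2 : 0 ≤ (B + 1 - j) * (b - (j + 1) : ℝ) := mul_nonneg (by linarith) (by linarith)
            have : 0 ≤ ((b : ℝ) - j) * (2 * (B + 1 - j) * b - (B + 1) * (2 * B - 3 * (j - 1))) :=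
              mul_nonneg (by linarith) (by linarith)
            linarith
          have h2 : ((b : ℝ) - j) * (B + 1) * (2 * B - 3 * m) ≤
              2 * (B + 1 - j) * ((b - 1 - m) * b) := by
            rcases eq_or_lt_of_le (by linarith : (1 : ℝ) ≤ j) with e | e
            · have : (m : ℝ) = 0 := by linarith
              rw [this]
              linarith
            · have f0 := mul_le_mul_of_nonneg_left h0 (by linarith : (0:ℝ) ≤ j - 1 - m)
              have f1 := mul_le_mul_of_nonneg_left h1 hm0
              refine le_of_mul_le_mul_left ?_ (by linarith : (0:ℝ) < j - 1)
              linarith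
          have h4 : 0 ≤ (B + 1 - j : ℝ) * (a * (m + 1 - a)) :=
            mul_nonneg (by linarith) (mul_nonneg ha0 (by linarith))
          push_cast
          linarith
    · have hE' : (2 * B : ℝ) ≤ 3 * m := by exact_mod_cast hE
      have h := main (2 * (B + 1 - j) + 2 * B * (B + 1)) (2 * B ^ 2 * (B + 1) / 3)
        (B * (B + 1)) ?_
      · have h3 : 0 ≤ (B ^ 2 * (B + 1) : ℝ) * (1 - 3 * η) :=
          mul_nonneg (by positivity) (by linarith)
        refine le_of_mul_le_mul_left ?_ (by linarith : (0 : ℝ) < B)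
        linarith
      · intro a b ha hb hbB
        have ha' : (a : ℝ) ≤ m := by exact_mod_cast ha
        have hb' : (m : ℝ) + 1 ≤ b := by exact_mod_cast hb
        have ha0 : (0 : ℝ) ≤ a := by positivity
        rw [Nat.sub_eq_zero_of_le (by omega : a ≤ j)]
        have h1 : 0 ≤ ((b : ℝ) - a) * ((B + 1 - j) * (a + b - 1)) :=
          mul_nonneg (by linarith) (mul_nonneg (by linarith) (by linarith))
        rcases le_or_gt b j with hbj | hbj
        · rw [Nat.sub_eq_zero_of_le hbj]
          have : 0 ≤ ((b : ℝ) - a) * ((B * (B + 1)) * (a + b - 1 - 2 * B / 3)) :=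
            mul_nonneg (by linarith) (mul_nonneg (by positivity) (by linarith))
          push_cast
          linarith
        · rw [Nat.cast_sub hbj.le]
          have hbj' : (j : ℝ) + 1 ≤ b := by exact_mod_cast hbj
          have h2 : 0 ≤ ((b : ℝ) - a) * ((B * (B + 1)) * (a + b - 1 - 2 * B / 3 - 1)) :=
            mul_nonneg (by linarith) (mul_nonneg (by positivity) (by linarith))
          have h3 : 0 ≤ (B * (B + 1)) * ((j : ℝ) - a) :=
            mul_nonneg (by positivity) (by linarith)
          push_cast
          linarith

open Finset in
/-- The expectation of a function of a random variable on the lattice `{0, 1/B, ..., 1}`. -/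
lemma integral_comp_eq_sum_of_lattice {Ω : Type*} [MeasurableSpace Ω] (P : Measure Ω)
    [IsProbabilityMeasure P] {B : ℕ} (hB : 1 ≤ B) {X : Ω → ℝ} (hX : Measurable X)
    (hlat : ∀ ω, ∃ i ≤ B, X ω = (i : ℝ) / B) (g : ℝ → ℝ) :
    ∫ ω, g (X ω) ∂P =
      ∑ i ∈ range (B + 1), (P {ω | X ω = (i : ℝ) / B}).toReal * g ((i : ℝ) / B) := by
  have hB' : (B : ℝ) ≠ 0 := by positivity
  have hms : ∀ i : ℕ, MeasurableSet {ω | X ω = (i : ℝ) / B} :=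
    fun i => hX (measurableSet_singleton _)
  have e : (fun ω => g (X ω)) = fun ω => ∑ i ∈ range (B + 1),
      Set.indicator {ω | X ω = (i : ℝ) / B} (fun _ => g ((i : ℝ) / B)) ω := by
    funext ω
    obtain ⟨k, hk, hkX⟩ := hlat ω
    rw [sum_eq_single k]
    · simp [hkX]
    · intro i _ hik
      refine Set.indicator_of_notMem ?_ _
      rw [Set.mem_ofPred_eq, hkX, div_left_inj' hB']
      exact_mod_cast hik.symm
    · intro h
      simp at h
      omega
  rw [e, integral_finsetSum _ fun i _ => (integrable_const _).indicator (hms i)]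
  refine sum_congr rfl fun i _ => ?_
  rw [integral_indicator_const _ (hms i)]
  rfl

/-- Markov's inequality under unimodality (Theorem 3 of Shah & Samworth (2013)),
third case: if `X` takes values in `{0, 1/B, ..., 1}` with unimodal pmf,
`η = E[X] ≤ 1/3`, and `t = j/B` satisfies `1/2 < t ≤ 1`, then
`P(X ≥ t) ≤ 2η(1 - t + 1/B)/(1 + 1/B)`. -/
theorem unimodal_markov_case3 {Ω : Type*} [MeasurableSpace Ω]
    (P : Measure Ω) [IsProbabilityMeasure P]
    (B : ℕ) (hB : 1 ≤ B) (X : Ω → ℝ) (hXmeas : Measurable X)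
    (hlat : ∀ ω, ∃ i ≤ B, X ω = (i : ℝ) / B)
    (huni : UnimodalOn B (fun i => (P {ω | X ω = (i : ℝ) / B}).toReal))
    (η : ℝ) (hη : η = ∫ ω, X ω ∂P) (hη3 : η ≤ 1 / 3)
    (j : ℕ) (hjB : j ≤ B) (t : ℝ) (ht : t = (j : ℝ) / B)
    (h1 : 1 / 2 < t) (h2 : t ≤ 1) :
    (P {ω | t ≤ X ω}).toReal ≤ 2 * η * (1 - t + 1 / B) / (1 + 1 / B) := by
  have hB0 : (0 : ℝ) < B := by exact_mod_cast hB
  have hI := integral_comp_eq_sum_of_lattice P hB hXmeas hlat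
  have hsum := hI fun _ => 1
  simp only [integral_const, probReal_univ, smul_eq_mul, mul_one] at hsum
  have hmean := hI fun x => x
  rw [← hη] at hmean
  have htail := hI (Set.indicator {x | t ≤ x} fun _ => 1)
  have htail' : ∫ ω, Set.indicator {x | t ≤ x} (fun _ => (1 : ℝ)) (X ω) ∂P =
      (P {ω | t ≤ X ω}).toReal :=
    integral_indicator_one (μ := P) (s := {ω | t ≤ X ω}) (hXmeas measurableSet_Ici)
  have hj : B < 2 * j := by
    rw [ht, lt_div_iff₀ hB0] at h1
    have : (B : ℝ) < 2 * j := by linarith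
    exact_mod_cast this
  have key := huni.markov hB (fun _ => ENNReal.toReal_nonneg) hsum.symm η (by
    rw [hmean, Finset.mul_sum]
    refine Finset.sum_congr rfl fun i _ => ?_
    rw [mul_left_comm, mul_div_cancel₀ _ hB0.ne']) hη3 hjB hj
  rw [← htail', htail]
  have e : 2 * η * (1 - t + 1 / B) / (1 + 1 / B) = 2 * (B + 1 - j) * η / (B + 1) := by
    rw [ht]
    field_simp
    ring
  rw [e, le_div_iff₀ (by positivity), mul_comm]
  refine (congrArg _ (Finset.sum_congr rfl fun i _ => ?_)).trans_le key
  simp [Set.indicator_apply, ht, div_le_div_iff_of_pos_right hB0]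
end

section
/- Let B ≥ 1 be an integer and let X be a random variable taking values in the lattice G = {0, 1/B, 2/B, ..., 1} whose probability mass function is unimodal. Let η = E[X], suppose η > 1/3, and define d = −2(η − 1/2)(6η + 1) + (2 − 4η)/B + (4η − 1)²/B². Suppose d > 0. Then for every t = j/B ∈ G with η < t ≤ 1: if t ≤ 1/2 + (1/(4η))(1 + 1/B − √d) then P(X ≥ t) ≤ (2η − t + 1/B)/(t + 1/B), while if t > 1/2 + (1/(4η))(1 + 1/B − √d) then P(X ≥ t) ≤ 2η(1 − t + 1/B)/(1 + 1/B). -/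
open MeasureTheory

open Finset

/-- To test the nonnegativity of `∑ f i * g i` over all nonnegative `f` which are unimodal with
mode `m`, it is enough to test indicators of intervals containing `m`. -/
theorem sum_mul_nonneg_of_unimodal (g : ℕ → ℝ) (m : ℕ) :
    ∀ (n a b : ℕ) (f : ℕ → ℝ), b - a = n → a ≤ m → m ≤ b →
      (∀ i j, a ≤ i → i ≤ j → j ≤ m → f i ≤ f j) →
      (∀ i j, m ≤ i → i ≤ j → j ≤ b → f j ≤ f i) →
      (∀ i, a ≤ i → i ≤ b → 0 ≤ f i) →
      (∀ a' b', a' ≤ m → m ≤ b' → b' ≤ b → 0 ≤ ∑ i ∈ Icc a' b', g i) →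
      0 ≤ ∑ i ∈ Icc a b, f i * g i := by
  intro n
  induction n with
  | zero =>
    intro a b f hn ha hb _ _ hf hg
    obtain rfl : a = b := by omega
    obtain rfl : a = m := by omega
    have h := hg a a le_rfl le_rfl le_rfl
    simp only [Icc_self, sum_singleton] at h ⊢
    exact mul_nonneg (hf a le_rfl le_rfl) h
  | succ n ih =>
    intro a b f hn ha hb hmono hanti hf hg
    have split : ∀ v : ℝ, ∑ i ∈ Icc a b, f i * g i
        = v * ∑ i ∈ Icc a b, g i + ∑ i ∈ Icc a b, (f i - v) * g i := by
      intro v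
      rw [mul_sum, ← sum_add_distrib]
      exact sum_congr rfl fun i _ => by ring
    have hab := hg a b ha hb le_rfl
    by_cases hleft : a < m ∧ (b = m ∨ f a ≤ f b)
    · obtain ⟨ham, hfb⟩ := hleft
      have hmin : ∀ i, a ≤ i → i ≤ b → f a ≤ f i := by
        intro i hi hib
        rcases le_total i m with him | him
        · exact hmono a i le_rfl hi him
        · rcases hfb with rfl | hfb
          · exact hmono a i le_rfl hi hib
          · exact hfb.trans (hanti i b him hib le_rfl)
      rw [split (f a), ← add_sum_Ioc_eq_sum_Icc (by omega : a ≤ b) (f := fun i => (f i - f a) * g i),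
        ← Icc_succ_left_eq_Ioc]
      have h := ih (a + 1) b (fun i => f i - f a) (by omega) (by omega) hb
        (fun i j hi hij hj => by have := hmono i j (by omega) hij hj; linarith)
        (fun i j hi hij hj => by have := hanti i j hi hij hj; linarith)
        (fun i hi hib => by have := hmin i (by omega) hib; linarith) hg
      have h0 := mul_nonneg (hf a le_rfl (by omega)) hab
      simp only [sub_self, zero_mul, zero_add, Order.succ_eq_add_one] at *
      linarith
    · have hmb : m < b := by
        rcases Nat.lt_or_ge m b with h | h
        · exact h
        · exact absurd ⟨by omega, Or.inl (by omega)⟩ hleft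
      have hmin : ∀ i, a ≤ i → i ≤ b → f b ≤ f i := by
        intro i hi hib
        rcases le_total m i with him | him
        · exact hanti i b him hib le_rfl
        · by_cases ham : a < m
          · have : f b < f a := by
              by_contra hcon
              exact hleft ⟨ham, Or.inr (not_lt.mp hcon)⟩
            exact this.le.trans (hmono a i le_rfl hi him)
          · obtain rfl : i = m := by omega
            exact hanti i b le_rfl hib le_rfl
      obtain ⟨c, rfl⟩ : ∃ c, b = c + 1 := ⟨b - 1, by omega⟩
      rw [split (f (c + 1)), sum_Icc_succ_top (by omega : a ≤ c + 1) (fun i => (f i - f (c + 1)) * g i)]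
      have h := ih a c (fun i => f i - f (c + 1)) (by omega) ha (by omega)
        (fun i j hi hij hj => by have := hmono i j hi hij hj; linarith)
        (fun i j hi hij hj => by have := hanti i j hi hij (by omega); linarith)
        (fun i hi hib => by have := hmin i hi (by omega); linarith)
        (fun a' b' ha' hb' hb'' => hg a' b' ha' hb' (by omega))
      have h0 := mul_nonneg (hf (c + 1) (by omega) le_rfl) hab
      simp only [sub_self, zero_mul, add_zero] at *
      linarith

theorem sum_Icc_two_mul_sub (M : ℝ) (a b : ℕ) (hab : a ≤ b + 1) :
    ∑ i ∈ Icc a b, (2 * (i : ℝ) - M) = ((b : ℝ) - a + 1) * (a + b - M) := by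
  induction b with
  | zero =>
    obtain rfl | rfl : a = 0 ∨ a = 1 := by omega
    · simp
    · simp
  | succ b ih =>
    rcases Nat.lt_or_ge (b + 1) a with h | h
    · obtain rfl : a = b + 2 := by omega
      rw [Icc_eq_empty (by omega)]
      push_cast
      rw [sum_empty]
      ring
    · rw [sum_Icc_succ_top h, ih (by omega)]
      push_cast
      ring

theorem sum_Icc_ite_le (j a b : ℕ) :
    ∑ i ∈ Icc a b, (if j ≤ i then (1 : ℝ) else 0) = ((b + 1 - max a j : ℕ) : ℝ) := by
  rw [← sum_filter, sum_const, nsmul_eq_mul, mul_one]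
  have : (Icc a b).filter (fun i => j ≤ i) = Icc (max a j) b := by
    ext i
    simp only [mem_filter, mem_Icc, max_le_iff]
    omega
  rw [this, Nat.card_Icc]

/-- An affine bound on the upper tail in terms of twice the mean, valid for the uniform law on
every interval containing the mode `m`, is valid for every unimodal law with mode `m`. -/
theorem tail_le_of_intervals (B m j : ℕ) (f : ℕ → ℝ) (A C M : ℝ) (hm : m ≤ B)
    (hmono : ∀ i j, i ≤ j → j ≤ m → f i ≤ f j)
    (hanti : ∀ i j, m ≤ i → i ≤ j → j ≤ B → f j ≤ f i)
    (hf : ∀ i, 0 ≤ f i) (h1 : ∑ i ∈ Icc 0 B, f i = 1)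
    (hint : ∀ a b : ℕ, a ≤ m → m ≤ b → b ≤ B →
      C * ((b + 1 - max a j : ℕ) : ℝ) ≤ A * (((b : ℝ) - a + 1) * (a + b - M))) :
    C * ∑ i ∈ Icc 0 B, f i * (if j ≤ i then (1 : ℝ) else 0)
      ≤ A * (2 * (∑ i ∈ Icc 0 B, f i * i) - M) := by
  have h := sum_mul_nonneg_of_unimodal
    (fun i => A * (2 * (i : ℝ) - M) - C * (if j ≤ i then (1 : ℝ) else 0)) m B 0 B f
    (by omega) (by omega) hm (fun i j _ => hmono i j) hanti (fun i _ _ => hf i) (by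
      intro a b ha hb hbB
      rw [sum_sub_distrib, ← mul_sum, ← mul_sum, sum_Icc_two_mul_sub M a b (by omega),
        sum_Icc_ite_le]
      linarith [hint a b ha hb hbB])
  have h' : ∑ i ∈ Icc 0 B, f i * (A * (2 * (i : ℝ) - M) - C * (if j ≤ i then (1 : ℝ) else 0))
      = A * (2 * (∑ i ∈ Icc 0 B, f i * i) - M * ∑ i ∈ Icc 0 B, f i)
        - C * ∑ i ∈ Icc 0 B, f i * (if j ≤ i then (1 : ℝ) else 0) := by
    simp only [mul_sum, ← sum_sub_distrib]
    exact sum_congr rfl fun i _ => by ring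
  rw [h', h1] at h
  linarith

theorem tail_le_of_le_mode (B m j : ℕ) (f : ℕ → ℝ) (hm : m ≤ B) (hjm : j ≤ m)
    (hmono : ∀ i j, i ≤ j → j ≤ m → f i ≤ f j)
    (hanti : ∀ i j, m ≤ i → i ≤ j → j ≤ B → f j ≤ f i)
    (hf : ∀ i, 0 ≤ f i) (h1 : ∑ i ∈ Icc 0 B, f i = 1) :
    ((j : ℝ) + 1) * ∑ i ∈ Icc 0 B, f i * (if j ≤ i then (1 : ℝ) else 0)
      ≤ 2 * (∑ i ∈ Icc 0 B, f i * i) - (j - 1) := by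
  have h := tail_le_of_intervals B m j f 1 (j + 1) (j - 1) hm hmono hanti hf h1 (by
    intro a b ha hb _
    rcases le_total j a with hja | hja
    · rw [max_eq_left hja, Nat.cast_sub (by omega)]
      have hab : (a : ℝ) ≤ b := by exact_mod_cast ha.trans hb
      have hja' : (j : ℝ) ≤ a := by exact_mod_cast hja
      push_cast
      nlinarith
    · rw [max_eq_right hja, Nat.cast_sub (by omega)]
      obtain ⟨c, rfl⟩ := Nat.exists_eq_add_of_le (hjm.trans hb)
      obtain ⟨e, rfl⟩ := Nat.exists_eq_add_of_le hja
      push_cast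
      have h1 : (0 : ℝ) ≤ a * e := by positivity
      have h2 : (0 : ℝ) ≤ (c : ℝ) * (c + 1) := by positivity
      nlinarith)
  linarith

theorem mul_sub_one_nonneg_of_int (z : ℤ) : 0 ≤ (z : ℝ) * (z - 1) := by
  have : 0 ≤ z * (z - 1) := by
    rcases le_or_gt z 0 with h | h
    · nlinarith
    · exact mul_nonneg h.le (by omega)
  exact_mod_cast this

/-- Below `j = k + 1`, the best chord from the uniform law on `{0, ..., m}` to a uniform law
on `{0, ..., b}` dominates the tail. -/
theorem tail_le_chord (B m k : ℕ) (f : ℕ → ℝ) (hk : k + 1 ≤ B) (hmk : m ≤ k)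
    (hmono : ∀ i j, i ≤ j → j ≤ m → f i ≤ f j)
    (hanti : ∀ i j, m ≤ i → i ≤ j → j ≤ B → f j ≤ f i)
    (hf : ∀ i, 0 ≤ f i) (h1 : ∑ i ∈ Icc 0 B, f i = 1) :
    ∃ b : ℕ, k + 1 ≤ b ∧ b ≤ B ∧
      ∑ i ∈ Icc 0 B, f i * (if k + 1 ≤ i then (1 : ℝ) else 0)
        ≤ ((b : ℝ) - k) / ((b - m) * (b + 1)) * (2 * (∑ i ∈ Icc 0 B, f i * i) - m) := by
  obtain ⟨c, hc, hmax⟩ := exists_max_image (Icc (k + 1) B)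
    (fun b : ℕ => ((b : ℝ) - k) / ((b - m) * (b + 1))) ⟨k + 1, by simp [hk]⟩
  rw [mem_Icc] at hc
  refine ⟨c, hc.1, hc.2, ?_⟩
  have hmk' : (m : ℝ) ≤ k := by exact_mod_cast hmk
  have hc1 : (k : ℝ) + 1 ≤ c := by exact_mod_cast hc.1
  set ρ : ℝ := ((c : ℝ) - k) / ((c - m) * (c + 1)) with hρ
  have hρ0 : 0 ≤ ρ := div_nonneg (by linarith) (mul_nonneg (by linarith) (by positivity))
  have h := tail_le_of_intervals B m (k + 1) f ρ 1 m (by omega) hmono hanti hf h1 (by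
    intro a b ha hb hbB
    have ha' : (a : ℝ) ≤ m := by exact_mod_cast ha
    have hb' : (m : ℝ) ≤ b := by exact_mod_cast hb
    have ha0 : (0 : ℝ) ≤ a := Nat.cast_nonneg a
    rw [one_mul, max_eq_right (by omega)]
    rcases Nat.lt_or_ge k b with hkb | hkb
    · rw [Nat.cast_sub (by omega)]
      have hkb' : (k : ℝ) + 1 ≤ b := by exact_mod_cast hkb
      have h3 := hmax b (by rw [mem_Icc]; omega)
      rw [div_le_iff₀ (mul_pos (by linarith) (by positivity))] at h3
      have h4 : ((b : ℝ) - m) * (b + 1) ≤ ((b : ℝ) - a + 1) * (a + b - m) := by nlinarith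
      have h5 := mul_le_mul_of_nonneg_left h4 hρ0
      push_cast
      linarith
    · rw [Nat.sub_eq_zero_of_le (by omega), Nat.cast_zero]
      exact mul_nonneg hρ0 (mul_nonneg (by linarith) (by linarith)))
  linarith

theorem tail_dichotomy (B j : ℕ) (f : ℕ → ℝ) (hj : 1 ≤ j) (hjB : j ≤ B)
    (huni : UnimodalOn B f) (hf : ∀ i, 0 ≤ f i) (h1 : ∑ i ∈ Icc 0 B, f i = 1)
    (S x : ℝ) (hS : S = ∑ i ∈ Icc 0 B, f i * (if j ≤ i then (1 : ℝ) else 0))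
    (hx : x = 2 * ∑ i ∈ Icc 0 B, f i * i) (hx3 : 2 * (B : ℝ) < 3 * x) :
    ((j : ℝ) + 1) * S ≤ x - (j - 1) ∨
      (x ≤ B ∧ (B : ℝ) * (B + 1) * S ≤ x * (B - j + 1)) := by
  obtain ⟨m, hm, hmono, hanti⟩ := huni
  rcases le_or_gt j m with hjm | hjm
  · left
    rw [hS, hx]
    exact tail_le_of_le_mode B m j f hm hjm hmono hanti hf h1
  obtain ⟨k, rfl⟩ : ∃ k, j = k + 1 := ⟨j - 1, by omega⟩
  obtain ⟨b, hkb, hbB, hb⟩ := tail_le_chord B m k f hjB (by omega) hmono hanti hf h1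
  rw [← hS, ← hx] at hb
  have hmk' : (m : ℝ) ≤ k := by exact_mod_cast (by omega : m ≤ k)
  have hm0 : (0 : ℝ) ≤ m := Nat.cast_nonneg m
  have hk0 : (0 : ℝ) ≤ k := Nat.cast_nonneg k
  have hkb' : (k : ℝ) + 1 ≤ b := by exact_mod_cast hkb
  have hbB' : (b : ℝ) ≤ B := by exact_mod_cast hbB
  have hden : (0 : ℝ) < ((b : ℝ) - m) * (b + 1) := mul_pos (by linarith) (by linarith)
  rw [div_mul_eq_mul_div, le_div_iff₀ hden] at hb
  push_cast
  rcases le_or_gt (b : ℝ) x with hxb | hxb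
  · left
    have hkey : ((b : ℝ) - k) * (x - m) * (k + 2) ≤ (x - k) * ((b - m) * (b + 1)) := by
      have e1 : ((b : ℝ) - k) * (k + 2) ≤ (b - m) * (b + 1) := by
        apply mul_le_mul <;> linarith
      have e2 : ((b : ℝ) - k) * (k + 2) ≤ (b - k) * (b + 1) := by
        apply mul_le_mul <;> linarith
      have e3 := mul_le_mul_of_nonneg_left e1 (sub_nonneg.mpr hxb)
      have e4 := mul_le_mul_of_nonneg_left e2 (by linarith : (0 : ℝ) ≤ b - m)
      nlinarith
    have h3 : S * (k + 2) * ((b - m) * (b + 1)) ≤ (x - k) * ((b - m) * (b + 1)) := by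
      nlinarith
    have := le_of_mul_le_mul_right h3 hden
    linarith
  · have hS0 : S * (b * (b + 1)) ≤ (b - k) * x := by
      have e1 : ((b : ℝ) - k) * (x - m) * b ≤ (b - k) * x * (b - m) := by
        have : 0 ≤ ((b : ℝ) - k) * (m * (b - x)) :=
          mul_nonneg (by linarith) (mul_nonneg hm0 (by linarith))
        nlinarith
      have e2 := mul_le_mul_of_nonneg_right hb (by linarith : (0 : ℝ) ≤ b)
      have e3 : S * (b * (b + 1)) * (b - m) ≤ (b - k) * x * (b - m) := by nlinarith
      exact le_of_mul_le_mul_right e3 (by linarith)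
    have hbpos : (0 : ℝ) < b * (b + 1) := by nlinarith
    have hxpos : (0 : ℝ) < x := by linarith
    rcases Nat.lt_or_ge (2 * k + 1) B with hB2 | hB2
    · left
      have hB2' : 2 * (k : ℝ) + 1 < B := by exact_mod_cast hB2
      have e1 : ((b : ℝ) - k) * (4 * k + 2) ≤ b * (b + 1) := by
        have := mul_sub_one_nonneg_of_int ((b : ℤ) - 2 * k)
        push_cast at this
        nlinarith
      have e2 := mul_le_mul_of_nonneg_left e1 hxpos.le
      have e3 : S * (4 * k + 2) * (b * (b + 1)) ≤ x * (b * (b + 1)) := by nlinarith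
      have e4 := le_of_mul_le_mul_right e3 hbpos
      have e5 : x * (k + 2) ≤ (x - k) * (4 * k + 2) := by
        have : 0 ≤ (k : ℝ) * (3 * x - (4 * k + 2)) := mul_nonneg hk0 (by linarith)
        nlinarith
      have e6 : S * (k + 2) * (4 * k + 2) ≤ (x - k) * (4 * k + 2) := by nlinarith
      have := le_of_mul_le_mul_right e6 (by linarith)
      linarith
    · right
      refine ⟨by linarith, ?_⟩
      have hB2' : (B : ℝ) ≤ 2 * k + 1 := by exact_mod_cast hB2
      have e1 : ((b : ℝ) - k) * (B * (B + 1)) ≤ (B - k) * (b * (b + 1)) := by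
        rcases hbB.eq_or_lt with h | h
        · rw [h]
        · have h' : (b : ℝ) + 1 ≤ B := by exact_mod_cast h
          have : 0 ≤ ((B : ℝ) - b) * (k * (B + 1) - (B - k) * b) := by
            refine mul_nonneg (by linarith) ?_
            nlinarith [mul_nonneg (by linarith : (0 : ℝ) ≤ B - k) (by linarith : (0 : ℝ) ≤ B - 1 - b)]
          nlinarith
      have e2 := mul_le_mul_of_nonneg_left e1 hxpos.le
      have e3 : S * (B * (B + 1)) * (b * (b + 1)) ≤ x * (B - k) * (b * (b + 1)) := by
        have : 0 ≤ (B : ℝ) * (B + 1) := by positivity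
        nlinarith [mul_le_mul_of_nonneg_right hS0 this]
      have := le_of_mul_le_mul_right e3 hbpos
      linarith

theorem integral_comp_lattice {Ω : Type*} [MeasurableSpace Ω]
    (P : Measure Ω) [IsProbabilityMeasure P]
    (B : ℕ) (hB : 1 ≤ B) (X : Ω → ℝ) (hXmeas : Measurable X)
    (hlat : ∀ ω, ∃ i ≤ B, X ω = (i : ℝ) / B) (φ : ℝ → ℝ) :
    ∫ ω, φ (X ω) ∂P =
      ∑ i ∈ Icc 0 B, (P {ω | X ω = (i : ℝ) / B}).toReal * φ ((i : ℝ) / B) := by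
  have hB0 : (B : ℝ) ≠ 0 := by exact_mod_cast (by omega : B ≠ 0)
  have hms : ∀ i : ℕ, MeasurableSet {ω | X ω = (i : ℝ) / B} := fun i =>
    hXmeas (measurableSet_singleton _)
  have hpt : ∀ ω, φ (X ω) = ∑ i ∈ Icc 0 B,
      Set.indicator {ω | X ω = (i : ℝ) / B} (fun _ => φ ((i : ℝ) / B)) ω := by
    intro ω
    obtain ⟨i, hi, hXi⟩ := hlat ω
    rw [sum_eq_single_of_mem i (by simp [hi])]
    · rw [Set.indicator_of_mem (by exact hXi), hXi]
    · intro l _ hli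
      refine Set.indicator_of_notMem ?_ _
      intro hl
      have hl' : X ω = (l : ℝ) / B := hl
      rw [hXi, div_left_inj' hB0] at hl'
      exact hli (by exact_mod_cast hl'.symm)
  simp_rw [hpt]
  rw [integral_finsetSum _ fun i _ => (integrable_const _).indicator (hms i)]
  refine sum_congr rfl fun i _ => ?_
  rw [integral_indicator_const _ (hms i), smul_eq_mul, Measure.real]

/-- The threshold in `t` separates the regimes in which either of the two bounds is larger. -/
theorem bound_of_threshold {η t h d S : ℝ} (hη0 : 0 < η) (h2 : t ≤ 1) (hh0 : 0 < h)
    (hh : h ≤ 1 / 2 ∨ h = 1) (hη1 : h = 1 → η ≤ 1)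
    (hd' : d = (2 * η - 1 - h) ^ 2 - 8 * η * (1 - h ^ 2) * (2 * η - 1)) (hdpos : 0 < d)
    (ht0 : 0 < t)
    (hbounds : S ≤ (2 * η - t + h) / (t + h) ∨
      (η ≤ 1 / 2 ∧ S ≤ 2 * η * (1 - t + h) / (1 + h))) :
    (t ≤ 1 / 2 + (1 / (4 * η)) * (1 + h - Real.sqrt d) → S ≤ (2 * η - t + h) / (t + h)) ∧
    (1 / 2 + (1 / (4 * η)) * (1 + h - Real.sqrt d) < t →
      S ≤ 2 * η * (1 - t + h) / (1 + h)) := by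
  have hs2 := Real.sq_sqrt hdpos.le
  have hs0 := Real.sqrt_pos.mpr hdpos
  set s := Real.sqrt d
  have hh1 : h ≤ 1 := by rcases hh with hh | hh <;> linarith
  set u : ℝ := 4 * η * t - 2 * η - (1 + h) with hu
  have hquad : 8 * η * ((2 * η - t + h) * (1 + h) - 2 * η * (1 - t + h) * (t + h))
      = u ^ 2 - s ^ 2 := by
    rw [hs2, hd', hu]
    ring
  have hthr : t ≤ 1 / 2 + (1 / (4 * η)) * (1 + h - s) ↔ u ≤ -s := by
    have : 1 / 2 + (1 / (4 * η)) * (1 + h - s) = (2 * η + (1 + h - s)) / (4 * η) := by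
      field_simp
      ring
    rw [this, le_div_iff₀ (by linarith), hu]
    constructor <;> intro <;> linarith
  have hu1 : u ≤ 2 * η - 1 - h := by rw [hu]; nlinarith
  constructor
  · intro hcase
    rw [hthr] at hcase
    rcases hbounds with hb | ⟨_, hb⟩
    · exact hb
    · refine hb.trans ?_
      rw [div_le_div_iff₀ (by linarith) (by linarith)]
      have : 0 ≤ u ^ 2 - s ^ 2 := by nlinarith
      rw [← hquad] at this
      have := nonneg_of_mul_nonneg_right this (by linarith : 0 < 8 * η)
      linarith
  · intro hcase
    rw [← not_le, hthr, not_le] at hcase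
    rcases le_or_gt η (1 / 2) with hη2 | hη2
    · rcases hbounds with hb | ⟨_, hb⟩
      · refine hb.trans ?_
        rw [div_le_div_iff₀ (by linarith) (by linarith)]
        have : 8 * η * ((2 * η - t + h) * (1 + h) - 2 * η * (1 - t + h) * (t + h)) ≤ 0 := by
          rw [hquad]
          have := mul_nonneg (by linarith : 0 ≤ s - u) (by linarith : 0 ≤ s + u)
          linarith
        have := nonpos_of_mul_nonpos_right this (by linarith : 0 < 8 * η)
        linarith
      · exact hb
    · exfalso
      have hv : 2 * η - 1 - h ≤ 0 := by
        rcases hh with hh | hh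
        · by_contra hcon
          push Not at hcon
          have e1 : 3 / 4 ≤ 1 - h ^ 2 := by nlinarith
          have e2 : 0 < η * (2 * η - 1) := mul_pos hη0 (by linarith)
          have e3 := mul_le_mul_of_nonneg_left e1 e2.le
          have e4 : (2 * η - 1 - h) ^ 2 ≤ (2 * η - 1) ^ 2 :=
            pow_le_pow_left₀ hcon.le (by linarith) 2
          have e5 : (2 * η - 1) ^ 2 ≤ 2 * (η * (2 * η - 1)) := by nlinarith
          linarith
        · linarith [hη1 hh]
      have hge : s ^ 2 ≤ (2 * η - 1 - h) ^ 2 := by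
        rw [hs2, hd']
        have : 0 ≤ η * (1 - h ^ 2) * (2 * η - 1) :=
          mul_nonneg (mul_nonneg hη0.le (by nlinarith)) (by linarith)
        linarith
      nlinarith

/-- Markov's inequality under unimodality (Theorem 3 of Shah & Samworth (2013)),
the case `η > 1/3`, `d > 0`: for `t = j/B` with `η < t ≤ 1`, if
`t ≤ 1/2 + (1/(4η))(1 + 1/B - √d)` then `P(X ≥ t) ≤ (2η - t + 1/B)/(t + 1/B)`,
while if `t > 1/2 + (1/(4η))(1 + 1/B - √d)` then
`P(X ≥ t) ≤ 2η(1 - t + 1/B)/(1 + 1/B)`. -/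
theorem unimodal_markov_dpos {Ω : Type*} [MeasurableSpace Ω]
    (P : Measure Ω) [IsProbabilityMeasure P]
    (B : ℕ) (hB : 1 ≤ B) (X : Ω → ℝ) (hXmeas : Measurable X)
    (hlat : ∀ ω, ∃ i ≤ B, X ω = (i : ℝ) / B)
    (huni : UnimodalOn B (fun i => (P {ω | X ω = (i : ℝ) / B}).toReal))
    (η : ℝ) (hη : η = ∫ ω, X ω ∂P) (hη3 : 1 / 3 < η)
    (d : ℝ)
    (hd : d = -2 * (η - 1 / 2) * (6 * η + 1) + (2 - 4 * η) / B + (4 * η - 1) ^ 2 / B ^ 2)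
    (hdpos : 0 < d)
    (j : ℕ) (hjB : j ≤ B) (t : ℝ) (ht : t = (j : ℝ) / B)
    (h1 : η < t) (h2 : t ≤ 1) :
    (t ≤ 1 / 2 + (1 / (4 * η)) * (1 + 1 / B - Real.sqrt d) →
      (P {ω | t ≤ X ω}).toReal ≤ (2 * η - t + 1 / B) / (t + 1 / B)) ∧
    (1 / 2 + (1 / (4 * η)) * (1 + 1 / B - Real.sqrt d) < t →
      (P {ω | t ≤ X ω}).toReal ≤ 2 * η * (1 - t + 1 / B) / (1 + 1 / B)) := by
  have hB0 : (0 : ℝ) < B := by exact_mod_cast hB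
  set f : ℕ → ℝ := fun i => (P {ω | X ω = (i : ℝ) / B}).toReal with hfdef
  have hj : 1 ≤ j := by
    rcases Nat.eq_zero_or_pos j with h | h
    · subst h
      simp only [Nat.cast_zero, zero_div] at ht
      linarith
    · exact h
  have hf1 : ∑ i ∈ Icc 0 B, f i = 1 := by
    have h := integral_comp_lattice P B hB X hXmeas hlat (fun _ => 1)
    simpa using h.symm
  have hmean : η * B = ∑ i ∈ Icc 0 B, f i * i := by
    rw [hη, integral_comp_lattice P B hB X hXmeas hlat (fun y => y), sum_mul]
    refine sum_congr rfl fun i _ => ?_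
    rw [mul_assoc, div_mul_cancel₀ _ hB0.ne']
  have htail : (P {ω | t ≤ X ω}).toReal
      = ∑ i ∈ Icc 0 B, f i * (if j ≤ i then (1 : ℝ) else 0) := by
    have h := integral_comp_lattice P B hB X hXmeas hlat
      (Set.indicator (Set.Ici t) (fun _ => 1))
    have h' : ∫ ω, Set.indicator (Set.Ici t) (fun _ => (1 : ℝ)) (X ω) ∂P
        = (P {ω | t ≤ X ω}).toReal := by
      have := integral_indicator_const (μ := P) (1 : ℝ)
        (hXmeas (measurableSet_Ici : MeasurableSet (Set.Ici t)))
      rw [smul_eq_mul, mul_one] at this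
      exact this
    rw [← h', h]
    refine sum_congr rfl fun i _ => ?_
    have hiff : (i : ℝ) / B ∈ Set.Ici t ↔ j ≤ i := by
      rw [Set.mem_Ici, ht, div_le_div_iff_of_pos_right hB0, Nat.cast_le]
    simp only [Set.indicator_apply, hiff, hfdef]
  set S : ℝ := (P {ω | t ≤ X ω}).toReal
  have hdich := tail_dichotomy B j f hj hjB huni (fun i => ENNReal.toReal_nonneg) hf1 S
    (2 * (η * B)) htail (by rw [hmean]) (by nlinarith)
  set h : ℝ := 1 / B with hhdef
  have hh0 : 0 < h := by positivity
  have hBh : (B : ℝ) * h = 1 := by rw [hhdef]; field_simp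
  have hjt : (j : ℝ) = t * B := by rw [ht]; field_simp
  have ht0 : 0 < t := by linarith
  have hη0 : 0 < η := by linarith
  have hbounds : S ≤ (2 * η - t + h) / (t + h) ∨
      (η ≤ 1 / 2 ∧ S ≤ 2 * η * (1 - t + h) / (1 + h)) := by
    rcases hdich with hd1 | ⟨hle, hd2⟩
    · left
      rw [le_div_iff₀ (by linarith)]
      rw [hjt] at hd1
      have := mul_le_mul_of_nonneg_left hd1 hh0.le
      linear_combination this - (S * t + t - 2 * η) * hBh
    · right
      refine ⟨by nlinarith, ?_⟩
      rw [le_div_iff₀ (by linarith)]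
      rw [hjt] at hd2
      have := mul_le_mul_of_nonneg_left hd2 (mul_pos hh0 hh0).le
      linear_combination this - (S * (B * h + 1 + h) - 2 * η * (1 - t) * (B * h + 1) - 2 * η * h) * hBh
  have hd' : d = (2 * η - 1 - h) ^ 2 - 8 * η * (1 - h ^ 2) * (2 * η - 1) := by
    rw [hd, hhdef]
    field_simp
    ring
  refine bound_of_threshold hη0 h2 hh0 ?_ (fun h' => ?_) hd' hdpos ht0 hbounds
  · rcases hB.eq_or_lt with h' | h'
    · right
      rw [hhdef, ← h']
      norm_num
    · left
      have h'' : (2 : ℝ) ≤ B := by exact_mod_cast h'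
      rw [hhdef]
      exact one_div_le_one_div_of_le (by norm_num) h''
  · linarith
end
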